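/- arXiv:1701.07410 — 3 statements merged into one kernel-verified Lean document; each statement's English description precedes it below -/
import Mathlib

section
/- For every 0 < σ < 1/2 and every θ ∈ ℝ, the regularized Flory–Huggins potential F̂ is twice continuously differentiable on all of ℝ. -/
open Real

theorem hasDerivAt_ite_le {a : ℝ} {f f' g g' : ℝ → ℝ}
    (hf : ∀ x, a ≤ x → HasDerivAt f (f' x) x) (hg : ∀ x, x ≤ a → HasDerivAt g (g' x) x)
    (hfg : f a = g a) (hfg' : f' a = g' a) (x : ℝ) :
    HasDerivAt (fun y => if a ≤ y then f y else g y) (if a ≤ x then f' x else g' x) x := by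
  rcases lt_trichotomy x a with hx | rfl | hx
  · rw [if_neg hx.not_ge]
    refine (hg x hx.le).congr_of_eventuallyEq ?_
    filter_upwards [Iio_mem_nhds hx] with y hy
    exact if_neg (not_le.2 hy)
  · rw [if_pos le_rfl]
    have hr : HasDerivWithinAt (fun y => if x ≤ y then f y else g y) (f' x) (Set.Ici x) x :=
      (hf x le_rfl).hasDerivWithinAt.congr_of_mem (fun y hy => if_pos hy) Set.self_mem_Ici
    have hl : HasDerivWithinAt (fun y => if x ≤ y then f y else g y) (f' x) (Set.Iic x) x := by
      rw [hfg']
      refine (hg x le_rfl).hasDerivWithinAt.congr_of_mem (fun y hy => ?_) Set.self_mem_Iic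
      rcases (Set.mem_Iic.1 hy).lt_or_eq with h | rfl
      · exact if_neg h.not_ge
      · simpa using hfg
    exact (hl.union hr).hasDerivAt (by simp [Set.Iic_union_Ici])
  · rw [if_pos hx.le]
    refine (hf x hx.le).congr_of_eventuallyEq ?_
    filter_upwards [Ioi_mem_nhds hx] with y hy
    exact if_pos (le_of_lt hy)

/-- The function `x * log x`, continued below `σ` by its second-order Taylor polynomial at `σ`. -/
noncomputable def regularizedMulLog (σ x : ℝ) : ℝ :=
  if σ ≤ x then x * Real.log x else x ^ 2 / (2 * σ) + x * Real.log σ - σ / 2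

theorem contDiff_regularizedMulLog {σ : ℝ} (hσ : 0 < σ) :
    ContDiff ℝ 2 (regularizedMulLog σ) := by
  have hd : ∀ x, HasDerivAt (regularizedMulLog σ)
      (if σ ≤ x then Real.log x + 1 else x / σ + Real.log σ) x := by
    refine hasDerivAt_ite_le (fun x hx => Real.hasDerivAt_mul_log (hσ.trans_le hx).ne')
      (fun x _ => ?_) (by field_simp; ring) (by field_simp; ring)
    convert! ((((hasDerivAt_id x).pow 2).div_const (2 * σ)).add
      ((hasDerivAt_id x).mul_const (Real.log σ))).sub_const (σ / 2) using 1
    simp only [id]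
    field_simp
    norm_num
    ring
  have hd' : ∀ x, HasDerivAt (fun y => if σ ≤ y then Real.log y + 1 else y / σ + Real.log σ)
      (if σ ≤ x then x⁻¹ else σ⁻¹) x := by
    refine hasDerivAt_ite_le
      (fun x hx => (Real.hasDerivAt_log (hσ.trans_le hx).ne').add_const 1)
      (fun x _ => ?_) (by field_simp; ring) rfl
    simpa using ((hasDerivAt_id x).div_const σ).add_const (Real.log σ)
  have hc : Continuous fun x : ℝ => if σ ≤ x then x⁻¹ else σ⁻¹ :=
    continuous_if_le continuous_const continuous_id
      (fun x hx => (continuousAt_inv₀ (hσ.trans_le hx).ne').continuousWithinAt)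
      continuousOn_const (fun x hx => by rw [hx])
  rw [show (2 : WithTop ℕ∞) = 1 + 1 by norm_num, contDiff_succ_iff_deriv]
  refine ⟨fun x => (hd x).differentiableAt, by simp, ?_⟩
  rw [funext fun x => (hd x).deriv, contDiff_one_iff_deriv]
  refine ⟨fun x => (hd' x).differentiableAt, ?_⟩
  rwa [funext fun x => (hd' x).deriv]

/-- For every `0 < σ < 1/2` and every `θ : ℝ`, the regularized Flory–Huggins
potential `F̂` is twice continuously differentiable on all of `ℝ`. -/
theorem regularized_FH_potential_C2
    (σ θ : ℝ) (hσ0 : 0 < σ) (hσ1 : σ < 1 / 2) (Fhat : ℝ → ℝ)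
    (hF : ∀ φ : ℝ, Fhat φ =
      if 1 - σ ≤ φ then
        φ * Real.log φ + (1 - φ) ^ 2 / (2 * σ) + (1 - φ) * Real.log σ - σ / 2
          + θ * (φ - φ ^ 2)
      else if σ ≤ φ then
        φ * Real.log φ + (1 - φ) * Real.log (1 - φ) + θ * (φ - φ ^ 2)
      else
        (1 - φ) * Real.log (1 - φ) + φ ^ 2 / (2 * σ) + φ * Real.log σ - σ / 2
          + θ * (φ - φ ^ 2)) :
    ContDiff ℝ 2 Fhat := by
  have hsum : Fhat = fun φ =>
      regularizedMulLog σ φ + regularizedMulLog σ (1 - φ) + θ * (φ - φ ^ 2) := by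
    funext φ
    rw [hF]
    unfold regularizedMulLog
    split_ifs with h₁ h₂ h₃ <;> try linarith
    obtain rfl : φ = 1 - σ := by linarith
    rw [sub_sub_cancel]
    field_simp
    ring
  rw [hsum]
  have hg := contDiff_regularizedMulLog hσ0
  have hg' : ContDiff ℝ 2 fun φ => regularizedMulLog σ (1 - φ) :=
    hg.comp (contDiff_const.sub contDiff_id)
  exact (hg.add hg').add (by fun_prop)
end

section
/- For every 0 < σ < 1/2 and every θ ∈ ℝ, the second derivative of the regularized Flory–Huggins potential F̂ is uniformly bounded from above: there exists a constant L such that F̂''(x) ≤ L for all x ∈ ℝ. -/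
open Real Set

/-- The second derivative of a function at a point of an open set, computed from a formula valid
on that set. -/
lemma deriv_deriv_eq_of_eqOn_isOpen {f g g' : ℝ → ℝ} {U : Set ℝ} {x c : ℝ} (hU : IsOpen U)
    (hx : x ∈ U) (hfg : EqOn f g U) (hg : ∀ y ∈ U, HasDerivAt g (g' y) y)
    (hg' : HasDerivAt g' c x) : deriv (deriv f) x = c := by
  have hderiv : EqOn (deriv f) g' U := fun y hy =>
    ((hg y hy).congr_of_eventuallyEq (hfg.eventuallyEq_of_mem (hU.mem_nhds hy))).deriv
  exact (hg'.congr_of_eventuallyEq (hderiv.eventuallyEq_of_mem (hU.mem_nhds hx))).deriv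

lemma hasDerivAt_one_sub_mul_log {x : ℝ} (hx : x < 1) :
    HasDerivAt (fun y : ℝ => (1 - y) * log (1 - y)) (-(log (1 - x) + 1)) x := by
  have h := (hasDerivAt_mul_log (sub_pos.2 hx).ne').comp x ((hasDerivAt_id x).const_sub 1)
  exact h.congr_deriv (by ring)

lemma hasDerivAt_log_one_sub {x : ℝ} (hx : x < 1) :
    HasDerivAt (fun y : ℝ => log (1 - y)) (-(1 - x)⁻¹) x := by
  have h := ((hasDerivAt_id x).const_sub 1).log (sub_pos.2 hx).ne'
  exact h.congr_deriv (by simp only [id]; ring)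

lemma hasDerivAt_const_mul_sub_sq (θ x : ℝ) :
    HasDerivAt (fun y : ℝ => θ * (y - y ^ 2)) (θ * (1 - 2 * x)) x := by
  have h := ((hasDerivAt_id x).sub ((hasDerivAt_id x).pow 2)).const_mul θ
  exact h.congr_deriv (by simp)

lemma hasDerivAt_const_mul_one_sub_two_mul (θ x : ℝ) :
    HasDerivAt (fun y : ℝ => θ * (1 - 2 * y)) (-2 * θ) x := by
  have h := (((hasDerivAt_id x).const_mul 2).const_sub 1).const_mul θ
  exact h.congr_deriv (by ring)

/-- For every `0 < σ < 1/2` and every `θ : ℝ`, the second derivative of the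
regularized Flory–Huggins potential `F̂` is uniformly bounded from above. -/
theorem regularized_FH_second_deriv_bounded_above
    (σ θ : ℝ) (hσ0 : 0 < σ) (hσ1 : σ < 1 / 2) (Fhat : ℝ → ℝ)
    (hF : ∀ φ : ℝ, Fhat φ =
      if 1 - σ ≤ φ then
        φ * Real.log φ + (1 - φ) ^ 2 / (2 * σ) + (1 - φ) * Real.log σ - σ / 2
          + θ * (φ - φ ^ 2)
      else if σ ≤ φ then
        φ * Real.log φ + (1 - φ) * Real.log (1 - φ) + θ * (φ - φ ^ 2)
      else
        (1 - φ) * Real.log (1 - φ) + φ ^ 2 / (2 * σ) + φ * Real.log σ - σ / 2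
          + θ * (φ - φ ^ 2)) :
    ∃ L : ℝ, ∀ x : ℝ, deriv (deriv Fhat) x ≤ L := by
  have bound_right : ∀ x, 1 - σ < x → deriv (deriv Fhat) x ≤ 2 * σ⁻¹ - 2 * θ := by
    intro x hx
    have hd : deriv (deriv Fhat) x = x⁻¹ + σ⁻¹ + -2 * θ := by
      refine deriv_deriv_eq_of_eqOn_isOpen (U := Ioi (1 - σ))
        (g := fun y => y * log y + (1 - y) ^ 2 / (2 * σ) + (1 - y) * log σ - σ / 2
          + θ * (y - y ^ 2))
        (g' := fun y => log y + 1 - (1 - y) / σ - log σ + θ * (1 - 2 * y))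
        isOpen_Ioi hx (fun y hy => ?_) (fun y hy => ?_) ?_
      · rw [hF, if_pos (mem_Ioi.1 hy).le]
      · have hy' : y ≠ 0 := by have := mem_Ioi.1 hy; linarith
        have hs := (hasDerivAt_id y).const_sub 1
        have h := ((((hasDerivAt_mul_log hy').add ((hs.pow 2).div_const (2 * σ))).add
          (hs.mul_const (log σ))).sub_const (σ / 2)).add (hasDerivAt_const_mul_sub_sq θ y)
        exact h.congr_deriv (by simp only [id]; field_simp; ring)
      · have hx' : x ≠ 0 := by linarith
        have hs := (hasDerivAt_id x).const_sub 1
        have h := (((((hasDerivAt_log hx').add_const 1).sub (hs.div_const σ)).sub_const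
          (log σ))).add (hasDerivAt_const_mul_one_sub_two_mul θ x)
        exact h.congr_deriv (by ring)
    have : x⁻¹ ≤ σ⁻¹ := inv_anti₀ hσ0 (by linarith)
    linarith
  have bound_mid : ∀ x, σ < x → x < 1 - σ → deriv (deriv Fhat) x ≤ 2 * σ⁻¹ - 2 * θ := by
    intro x hx₁ hx₂
    have hd : deriv (deriv Fhat) x = x⁻¹ + (1 - x)⁻¹ + -2 * θ := by
      refine deriv_deriv_eq_of_eqOn_isOpen (U := Ioo σ (1 - σ))
        (g := fun y => y * log y + (1 - y) * log (1 - y) + θ * (y - y ^ 2))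
        (g' := fun y => log y - log (1 - y) + θ * (1 - 2 * y))
        isOpen_Ioo ⟨hx₁, hx₂⟩ (fun y hy => ?_) (fun y hy => ?_) ?_
      · rw [hF, if_neg hy.2.not_ge, if_pos hy.1.le]
      · have h := ((hasDerivAt_mul_log (hσ0.trans hy.1).ne').add
          (hasDerivAt_one_sub_mul_log (by linarith [hy.2]))).add
          (hasDerivAt_const_mul_sub_sq θ y)
        exact h.congr_deriv (by ring)
      · have h := ((hasDerivAt_log (hσ0.trans hx₁).ne').sub
          (hasDerivAt_log_one_sub (by linarith))).add
          (hasDerivAt_const_mul_one_sub_two_mul θ x)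
        exact h.congr_deriv (by ring)
    have h₁ : x⁻¹ ≤ σ⁻¹ := inv_anti₀ hσ0 hx₁.le
    have h₂ : (1 - x)⁻¹ ≤ σ⁻¹ := inv_anti₀ hσ0 (by linarith)
    linarith
  have bound_left : ∀ x, x < σ → deriv (deriv Fhat) x ≤ 2 * σ⁻¹ - 2 * θ := by
    intro x hx
    have hd : deriv (deriv Fhat) x = (1 - x)⁻¹ + σ⁻¹ + -2 * θ := by
      refine deriv_deriv_eq_of_eqOn_isOpen (U := Iio σ)
        (g := fun y => (1 - y) * log (1 - y) + y ^ 2 / (2 * σ) + y * log σ - σ / 2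
          + θ * (y - y ^ 2))
        (g' := fun y => -(log (1 - y) + 1) + y / σ + log σ + θ * (1 - 2 * y))
        isOpen_Iio hx (fun y hy => ?_) (fun y hy => ?_) ?_
      · have hy' := mem_Iio.1 hy
        rw [hF, if_neg (by linarith), if_neg hy'.not_ge]
      · have hy' := mem_Iio.1 hy
        have hi := hasDerivAt_id y
        have h := ((((hasDerivAt_one_sub_mul_log (by linarith)).add
          ((hi.pow 2).div_const (2 * σ))).add
          (hi.mul_const (log σ))).sub_const (σ / 2)).add (hasDerivAt_const_mul_sub_sq θ y)
        exact h.congr_deriv (by simp only [id]; field_simp; ring)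
      · have h := (((((hasDerivAt_log_one_sub (by linarith)).add_const 1).neg).add
          ((hasDerivAt_id x).div_const σ)).add_const (log σ)).add
          (hasDerivAt_const_mul_one_sub_two_mul θ x)
        exact h.congr_deriv (by ring)
    have : (1 - x)⁻¹ ≤ σ⁻¹ := inv_anti₀ hσ0 (by linarith)
    linarith
  -- The two gluing points contribute only two further values.
  refine ⟨max (2 * σ⁻¹ - 2 * θ) (max (deriv (deriv Fhat) σ) (deriv (deriv Fhat) (1 - σ))),
    fun x => ?_⟩
  rcases lt_trichotomy x σ with h | rfl | h
  · exact le_max_of_le_left (bound_left x h)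
  · exact le_max_of_le_right (le_max_left _ _)
  · rcases lt_trichotomy x (1 - σ) with h' | rfl | h'
    · exact le_max_of_le_left (bound_mid x h h')
    · exact le_max_of_le_right (le_max_right _ _)
    · exact le_max_of_le_left (bound_right x h')
end

section
/- If 0 < σ < 1/2 and 0 < θ < 1/(2σ), then the regularized Flory–Huggins potential F̂ is bounded from below: there exists a constant B such that F̂(x) + B > 0 for every x ∈ ℝ. -/
open Real

theorem sub_one_le_mul_log {y : ℝ} (hy : 0 < y) : y - 1 ≤ y * Real.log y := by
  have h := mul_le_mul_of_nonneg_left (Real.one_sub_inv_le_log_of_pos hy) hy.le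
  rwa [mul_sub, mul_one, mul_inv_cancel₀ hy.ne'] at h

theorem neg_sq_div_le_quadratic {k : ℝ} (hk : 0 < k) (b u : ℝ) :
    -(b ^ 2 / (4 * k)) ≤ k * u ^ 2 + b * u := by
  have h : k * u ^ 2 + b * u + b ^ 2 / (4 * k) = (2 * k * u + b) ^ 2 / (4 * k) := by
    field_simp
    ring
  have h' : 0 ≤ (2 * k * u + b) ^ 2 / (4 * k) := by positivity
  linarith

/-- Lower bound for an outer branch of the regularized potential, in terms of the
distance `u` to the pure phase; here `L` stands for `log σ`. -/
theorem outer_branch_lower_bound {σ θ L u : ℝ} (hθ : θ < 1 / (2 * σ)) (hu : u < 1) :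
    -((L + θ - 1) ^ 2 / (4 * (1 / (2 * σ) - θ))) - σ / 2 ≤
      (1 - u) * Real.log (1 - u) + u ^ 2 / (2 * σ) + u * L - σ / 2 + θ * (u - u ^ 2) := by
  have h1 := sub_one_le_mul_log (sub_pos.2 hu)
  have h2 := neg_sq_div_le_quadratic (sub_pos.2 hθ) (L + θ - 1) u
  have h3 : u ^ 2 / (2 * σ) = 1 / (2 * σ) * u ^ 2 := by ring
  linarith

/-- If `0 < σ < 1/2` and `0 < θ < 1/(2σ)`, then the regularized Flory–Huggins
potential `F̂` is bounded from below: there is a constant `B` with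
`F̂ x + B > 0` for every `x : ℝ`. -/
theorem regularized_FH_bounded_below
    (σ θ : ℝ) (hσ0 : 0 < σ) (hσ1 : σ < 1 / 2)
    (hθ0 : 0 < θ) (hθ1 : θ < 1 / (2 * σ)) (Fhat : ℝ → ℝ)
    (hF : ∀ φ : ℝ, Fhat φ =
      if 1 - σ ≤ φ then
        φ * Real.log φ + (1 - φ) ^ 2 / (2 * σ) + (1 - φ) * Real.log σ - σ / 2
          + θ * (φ - φ ^ 2)
      else if σ ≤ φ then
        φ * Real.log φ + (1 - φ) * Real.log (1 - φ) + θ * (φ - φ ^ 2)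
      else
        (1 - φ) * Real.log (1 - φ) + φ ^ 2 / (2 * σ) + φ * Real.log σ - σ / 2
          + θ * (φ - φ ^ 2)) :
    ∃ B : ℝ, ∀ x : ℝ, Fhat x + B > 0 := by
  have hC : 0 ≤ (Real.log σ + θ - 1) ^ 2 / (4 * (1 / (2 * σ) - θ)) := by
    have := sub_pos.2 hθ1
    positivity
  refine ⟨(Real.log σ + θ - 1) ^ 2 / (4 * (1 / (2 * σ) - θ)) + σ / 2 + 2, fun x => ?_⟩
  rw [hF]
  split_ifs with h1 h2
  · have h := outer_branch_lower_bound (L := Real.log σ) hθ1 (show 1 - x < 1 by linarith)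
    rw [sub_sub_cancel] at h
    linarith
  · have hx := sub_one_le_mul_log (show 0 < x by linarith)
    have hx' := sub_one_le_mul_log (show 0 < 1 - x by linarith)
    have hθx : 0 ≤ θ * (x - x ^ 2) := mul_nonneg hθ0.le (by nlinarith)
    linarith
  · have h := outer_branch_lower_bound (L := Real.log σ) hθ1 (show x < 1 by linarith)
    linarith
end
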